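/- Let I = (c,d) ⊂ ℝ, p ∈ (1,∞), p' = p/(p−1), w : I → (0,∞) measurable with ∫_x^d w^p < ∞ for all x ∈ I. If Λ is a continuous linear functional on the altered Cesàro space Ch_{p,w}(I), then there exists h with h/w ∈ L^{p'}(I) such that Λ f = ∫_I h(x) (∫_c^x f(t) dt) dx for all f ∈ Ch_{p,w}(I), and the operator norm of Λ equals (∫_I |h/w|^{p'})^{1/p'}. -/

import Mathlib

open MeasureTheory Set Filter

/-- membership in the altered Cesàro space `Ch_{p,w}((c,d))` (case ν = 1) -/
def memCh (c d p : ℝ) (w f : ℝ → ℝ) : Prop :=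
  Measurable f ∧ (∀ x ∈ Ioo c d, IntegrableOn f (Ioc c x)) ∧
    IntegrableOn (fun x => |w x * ∫ t in Ioc c x, f t| ^ p) (Ioo c d)

/-- seminorm of the altered Cesàro space -/
noncomputable def chNorm (c d p : ℝ) (w f : ℝ → ℝ) : ℝ :=
  (∫ x in Ioo c d, |w x * ∫ t in Ioc c x, f t| ^ p) ^ (1/p)

section LpDuality

open scoped ENNReal Topology symmDiff

variable {α : Type*} [MeasurableSpace α] {μ : Measure α} [IsFiniteMeasure μ]

/-- The indicators of a disjoint sequence of measurable sets sum up to the indicator of the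
whole union in `Lᵖ`, for `p` finite and `μ` finite. -/
theorem hasSum_indicatorConstLp {p : ℝ≥0∞} [Fact (1 ≤ p)] (hp : p ≠ ∞) {s : ℕ → Set α}
    (hs : ∀ i, MeasurableSet (s i)) (hd : Pairwise (Function.onFun Disjoint s)) :
    HasSum (fun i => indicatorConstLp p (hs i) (measure_ne_top μ _) (1 : ℝ))
      (indicatorConstLp p (MeasurableSet.iUnion hs) (measure_ne_top μ _) (1 : ℝ)) := by
  have hpart : ∀ F : Finset ℕ, ∑ i ∈ F, indicatorConstLp p (hs i) (measure_ne_top μ _) (1 : ℝ)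
      = indicatorConstLp p (F.measurableSet_biUnion fun i _ => hs i)
        (measure_ne_top μ (⋃ i ∈ F, s i)) (1 : ℝ) := by
    intro F
    induction F using Finset.induction_on with
    | empty => simp
    | insert a F ha ih =>
      rw [Finset.sum_insert ha, ih, ← indicatorConstLp_disjoint_union (hs a)
        (F.measurableSet_biUnion fun i _ => hs i)]
      · congr 1
        simp
      · rw [Set.disjoint_iUnion₂_right]
        intro i hi
        exact hd (fun h => ha (h ▸ hi))
  unfold HasSum
  simp only [hpart]
  refine tendsto_indicatorConstLp_set hp ?_
  have hfin : ∑' i, μ (s i) ≠ ∞ := by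
    rw [← measure_iUnion hd hs]
    exact measure_ne_top μ _
  refine tendsto_of_tendsto_of_tendsto_of_le_of_le tendsto_const_nhds
    (ENNReal.tendsto_tsum_compl_atTop_zero hfin) (fun _ => zero_le) fun F => ?_
  refine (measure_mono ?_).trans (measure_iUnion_le fun i : {x // x ∉ F} => s i)
  rintro x (⟨hx, hx'⟩ | ⟨hx, hx'⟩)
  · simp only [mem_iUnion] at hx hx'
    obtain ⟨i, -, hi⟩ := hx
    exact absurd ⟨i, hi⟩ hx'
  · simp only [mem_iUnion, not_exists] at hx hx'
    obtain ⟨i, hi⟩ := hx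
    exact mem_iUnion.2 ⟨⟨i, fun h => hx' i h hi⟩, hi⟩

/-- A continuous linear functional on `Lᵖ` of a finite measure is, on indicators, integration
against an integrable function. -/
theorem exists_integrable_dual_indicatorConstLp {p : ℝ≥0∞} [Fact (1 ≤ p)] (hp : p ≠ ∞)
    (ℓ : StrongDual ℝ (Lp ℝ p μ)) :
    ∃ g : α → ℝ, Measurable g ∧ Integrable g μ ∧ ∀ (s : Set α) (hs : MeasurableSet s),
      ℓ (indicatorConstLp p hs (measure_ne_top μ s) 1) = ∫ x in s, g x ∂μ := by
  classical
  let ν : SignedMeasure α :=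
    { measureOf' := fun s => if hs : MeasurableSet s then
        ℓ (indicatorConstLp p hs (measure_ne_top μ s) 1) else 0
      empty' := by simp
      not_measurable' := fun s hs => by simp [hs]
      m_iUnion' := fun s hs hd => by
        simp only [hs, MeasurableSet.iUnion hs, dif_pos]
        exact (hasSum_indicatorConstLp hp hs hd).mapL ℓ }
  have hν : ∀ (s : Set α) (hs : MeasurableSet s),
      ν s = ℓ (indicatorConstLp p hs (measure_ne_top μ s) 1) := fun s hs => dif_pos hs
  have hac : ν ≪ᵥ μ.toENNRealVectorMeasure := by
    refine VectorMeasure.AbsolutelyContinuous.mk fun s hs h0 => ?_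
    rw [Measure.toENNRealVectorMeasure_apply_measurable hs] at h0
    rw [hν s hs]
    have hp0 : p ≠ 0 := (one_pos.trans_le (Fact.out : 1 ≤ p)).ne'
    have : indicatorConstLp p hs (measure_ne_top μ s) (1 : ℝ) = 0 := by
      rw [← norm_eq_zero, norm_indicatorConstLp hp0 hp]
      simp [Measure.real, h0, ENNReal.toReal_eq_zero_iff, hp0, hp]
    rw [this, map_zero]
  refine ⟨ν.rnDeriv μ, SignedMeasure.measurable_rnDeriv _ _, SignedMeasure.integrable_rnDeriv _ _,
    fun s hs => ?_⟩
  rw [← hν s hs, ← withDensityᵥ_apply (SignedMeasure.integrable_rnDeriv _ _) hs,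
    SignedMeasure.withDensityᵥ_rnDeriv_eq ν μ hac]

theorem dual_simpleFunc_eq_integral {p : ℝ≥0∞} [Fact (1 ≤ p)]
    (ℓ : StrongDual ℝ (Lp ℝ p μ)) {g : α → ℝ} (hg : Integrable g μ)
    (h : ∀ (s : Set α) (hs : MeasurableSet s),
      ℓ (indicatorConstLp p hs (measure_ne_top μ s) 1) = ∫ x in s, g x ∂μ) (f : SimpleFunc α ℝ) :
    ℓ ((f.memLp_of_isFiniteMeasure p μ).toLp f) = ∫ x, g x * f x ∂μ := by
  induction f using SimpleFunc.induction with
  | const c hs =>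
    rename_i s
    have : ((SimpleFunc.piecewise s hs (SimpleFunc.const α c)
        (SimpleFunc.const α 0)).memLp_of_isFiniteMeasure p μ).toLp _
        = c • indicatorConstLp p hs (measure_ne_top μ s) 1 := by
      rw [indicatorConstLp, ← MemLp.toLp_const_smul]
      refine MemLp.toLp_congr _ _ (.of_forall fun x => ?_)
      by_cases hx : x ∈ s <;> simp [hx]
    rw [this, map_smul, h s hs, ← integral_indicator hs, smul_eq_mul, ← integral_const_mul]
    congr 1
    ext x
    by_cases hx : x ∈ s <;> simp [hx, mul_comm]
  | add _ ih₁ ih₂ =>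
    rename_i f₁ f₂ _
    have hi : ∀ f : SimpleFunc α ℝ, Integrable (fun x => g x * f x) μ := fun f =>
      hg.mul_of_top_left (f.memLp_top μ)
    have : ((f₁ + f₂).memLp_of_isFiniteMeasure p μ).toLp _
        = (f₁.memLp_of_isFiniteMeasure p μ).toLp _ + (f₂.memLp_of_isFiniteMeasure p μ).toLp _ := by
      rw [← MemLp.toLp_add]
      exact MemLp.toLp_congr _ _ (.of_forall fun x => by simp)
    rw [this, map_add, ih₁, ih₂, ← integral_add (hi _) (hi _)]
    simp [mul_add]

theorem abs_integral_mul_le_of_dual {p : ℝ} (hp : 1 < p) [Fact (1 ≤ ENNReal.ofReal p)]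
    (ℓ : StrongDual ℝ (Lp ℝ (ENNReal.ofReal p) μ)) {g : α → ℝ} (hg : Integrable g μ)
    (h : ∀ (s : Set α) (hs : MeasurableSet s),
      ℓ (indicatorConstLp _ hs (measure_ne_top μ s) 1) = ∫ x in s, g x ∂μ)
    {φ : α → ℝ} (hφ : Measurable φ) {C : ℝ} (hC : ∀ x, |φ x| ≤ C) :
    |∫ x, g x * φ x ∂μ| ≤ ‖ℓ‖ * (∫ x, |φ x| ^ p ∂μ) ^ (1 / p) := by
  have hp0 : 0 < p := one_pos.trans hp
  have hsm := hφ.stronglyMeasurable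
  set f := hsm.approxBounded C with hf
  have hfC : ∀ n x, ‖f n x‖ ≤ |C| := fun n x =>
    (hsm.norm_approxBounded_le ((abs_nonneg _).trans (hC x)) n x).trans (le_abs_self C)
  have hlim : ∀ x, Tendsto (fun n => f n x) atTop (𝓝 (φ x)) := fun x =>
    hsm.tendsto_approxBounded_of_norm_le (hC x)
  have h1 : Tendsto (fun n => |∫ x, g x * f n x ∂μ|) atTop (𝓝 |∫ x, g x * φ x ∂μ|) := by
    refine (tendsto_integral_of_dominated_convergence (fun x => |C| * |g x|) (fun n => ?_)
      (hg.abs.const_mul _) (fun n => ?_) ?_).abs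
    · exact hg.aestronglyMeasurable.mul (f n).aestronglyMeasurable
    · refine .of_forall fun x => ?_
      rw [norm_mul, mul_comm]
      exact mul_le_mul_of_nonneg_right (hfC n x) (norm_nonneg _)
    · exact .of_forall fun x => (hlim x).const_mul _
  have h2 : Tendsto (fun n => ‖ℓ‖ * (∫ x, |f n x| ^ p ∂μ) ^ (1 / p)) atTop
      (𝓝 (‖ℓ‖ * (∫ x, |φ x| ^ p ∂μ) ^ (1 / p))) := by
    refine (Tendsto.rpow_const ?_ (.inr (by positivity))).const_mul _
    refine tendsto_integral_of_dominated_convergence (fun _ => |C| ^ p) (fun n => ?_)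
      (integrable_const _) (fun n => ?_) ?_
    · exact ((f n).measurable.norm.pow_const p).aestronglyMeasurable
    · refine .of_forall fun x => ?_
      rw [Real.norm_eq_abs, Real.abs_rpow_of_nonneg (abs_nonneg _), abs_abs]
      exact Real.rpow_le_rpow (abs_nonneg _) (hfC n x) hp0.le
    · exact .of_forall fun x => (hlim x).abs.rpow_const (.inr hp0.le)
  refine le_of_tendsto_of_tendsto' h1 h2 fun n => ?_
  have hm := (f n).memLp_of_isFiniteMeasure (ENNReal.ofReal p) μ
  rw [← dual_simpleFunc_eq_integral ℓ hg h (f n)]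
  refine (ℓ.le_opNorm _).trans_eq ?_
  rw [Lp.norm_toLp, hm.eLpNorm_eq_integral_rpow_norm (by simpa using hp0) (by simp),
    ENNReal.toReal_ofReal (by positivity), ENNReal.toReal_ofReal hp0.le]
  simp [one_div]

/-- A measurable function that is controlled by `M` against bounded functions in the `Lᵖ` sense
lies in the conjugate `L^q`, with norm at most `M`. -/
theorem integrable_rpow_of_abs_integral_mul_le {p q : ℝ} (hpq : p.HolderConjugate q) {g : α → ℝ}
    (hg : Measurable g) {M : ℝ} (hM : 0 ≤ M)
    (h : ∀ φ : α → ℝ, Measurable φ → (∃ C, ∀ x, |φ x| ≤ C) →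
      |∫ x, g x * φ x ∂μ| ≤ M * (∫ x, |φ x| ^ p ∂μ) ^ (1 / p)) :
    Integrable (fun x => |g x| ^ q) μ ∧ (∫ x, |g x| ^ q ∂μ) ^ (1 / q) ≤ M := by
  have hp0 := hpq.pos
  have hq0 := hpq.symm.pos
  have hq1 := hpq.symm.lt
  have hpq' : (q - 1) * p = q := by
    have := hpq.symm.sub_one_mul_conj
    linarith
  let A : ℕ → Set α := fun n => {x | |g x| ≤ n}
  have hA : ∀ n, MeasurableSet (A n) := fun n => measurableSet_le hg.norm measurable_const
  have hAint : ∀ n, IntegrableOn (fun x => |g x| ^ q) (A n) μ := fun n => by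
    refine Measure.integrableOn_of_bounded (M := (n : ℝ) ^ q) (measure_ne_top _ _)
      (hg.norm.pow_const q).aestronglyMeasurable ?_
    filter_upwards [ae_restrict_mem (hA n)] with x hx
    rw [Real.norm_eq_abs, Real.abs_rpow_of_nonneg (abs_nonneg _), abs_abs]
    exact Real.rpow_le_rpow (abs_nonneg _) hx hq0.le
  have hJ : ∀ n, ∫ x in A n, |g x| ^ q ∂μ ≤ M ^ q := by
    intro n
    set J := ∫ x in A n, |g x| ^ q ∂μ with hJ
    have hJ0 : 0 ≤ J := integral_nonneg fun x => by positivity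
    let φ : α → ℝ := (A n).indicator fun x => SignType.sign (g x) * |g x| ^ (q - 1)
    have hφm : Measurable φ := by
      refine Measurable.indicator (Measurable.mul ?_ (hg.norm.pow_const _)) (hA n)
      have : (fun x => ((SignType.sign (g x) : SignType) : ℝ))
          = fun x => if 0 < g x then 1 else if g x < 0 then -1 else 0 := by
        ext x
        simp only [sign_apply]
        split_ifs <;> simp
      rw [this]
      exact Measurable.ite (measurableSet_lt measurable_const hg) measurable_const
        (Measurable.ite (measurableSet_lt hg measurable_const) measurable_const measurable_const)
    have habs : ∀ x, |φ x| = (A n).indicator (fun x => |g x| ^ (q - 1)) x := by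
      intro x
      by_cases hx : x ∈ A n
      · simp only [φ, indicator_of_mem hx, abs_mul, Real.abs_rpow_of_nonneg (abs_nonneg _), abs_abs]
        rcases lt_trichotomy (g x) 0 with h0 | h0 | h0
        · simp [sign_neg h0]
        · simp [h0, Real.zero_rpow (sub_pos.2 hq1).ne']
        · simp [sign_pos h0]
      · simp [φ, hx]
    have h1 := h φ hφm ⟨(n : ℝ) ^ (q - 1), fun x => by
      rw [habs]
      refine indicator_apply_le' (fun hx => ?_) fun _ => by positivity
      exact Real.rpow_le_rpow (abs_nonneg _) hx (sub_pos.2 hq1).le⟩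
    have h2 : ∫ x, g x * φ x ∂μ = J := by
      rw [hJ, ← integral_indicator (hA n)]
      congr 1
      ext x
      by_cases hx : x ∈ A n
      · simp only [φ, indicator_of_mem hx]
        rw [← mul_assoc, mul_comm (g x), sign_mul_self]
        rcases eq_or_ne (g x) 0 with h0 | h0
        · simp [h0, hq0.ne']
        · rw [← Real.rpow_one_add' (abs_nonneg _) (by simpa using hq0.ne')]
          simp
      · simp [φ, hx]
    have h3 : ∫ x, |φ x| ^ p ∂μ = J := by
      rw [hJ, ← integral_indicator (hA n)]
      congr 1
      ext x
      rw [habs]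
      by_cases hx : x ∈ A n
      · simp only [indicator_of_mem hx]
        rw [← Real.rpow_mul (abs_nonneg _), hpq']
      · simp [hx, hp0.ne']
    rw [h2, h3, abs_of_nonneg hJ0] at h1
    rcases hJ0.eq_or_lt with h0 | h0
    · rw [← h0]
      positivity
    · have h4 : J ^ (1 / q) ≤ M := by
        have h5 : J ^ (1 / q) * J ^ (1 / p) = J := by
          rw [← Real.rpow_add h0, one_div, one_div, hpq.symm.inv_add_inv_eq_one, Real.rpow_one]
        exact le_of_mul_le_mul_right (h5.trans_le h1) (Real.rpow_pos_of_pos h0 _)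
      calc J = (J ^ (1 / q)) ^ q := by
            rw [← Real.rpow_mul hJ0, one_div_mul_cancel hq0.ne', Real.rpow_one]
        _ ≤ M ^ q := Real.rpow_le_rpow (by positivity) h4 hq0.le
  have hU : ⋃ n, A n = univ := eq_univ_of_forall fun x =>
    mem_iUnion.2 (exists_nat_ge |g x|)
  have hL : ∫⁻ x, ENNReal.ofReal (|g x| ^ q) ∂μ ≤ ENNReal.ofReal (M ^ q) := by
    rw [← setLIntegral_univ, ← hU, setLIntegral_iUnion_of_directed]
    · refine iSup_le fun n => ?_
      rw [← ofReal_integral_eq_lintegral_ofReal (hAint n) (.of_forall fun x => by positivity)]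
      exact ENNReal.ofReal_le_ofReal (hJ n)
    · exact (monotone_nat_of_le_succ fun n x (hx : |g x| ≤ n) =>
        show |g x| ≤ (n + 1 : ℕ) from hx.trans (by simp)).directed_le
  have hgInt : Integrable (fun x => |g x| ^ q) μ := by
    refine ⟨(hg.norm.pow_const q).aestronglyMeasurable, ?_⟩
    rw [hasFiniteIntegral_iff_ofReal (.of_forall fun x => by positivity)]
    exact hL.trans_lt ENNReal.ofReal_lt_top
  refine ⟨hgInt, ?_⟩
  rw [← ofReal_integral_eq_lintegral_ofReal hgInt (.of_forall fun x => by positivity),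
    ENNReal.ofReal_le_ofReal_iff (by positivity)] at hL
  calc (∫ x, |g x| ^ q ∂μ) ^ (1 / q) ≤ (M ^ q) ^ (1 / q) :=
        Real.rpow_le_rpow (integral_nonneg fun x => by positivity) hL (by positivity)
    _ = M := by rw [← Real.rpow_mul hM, mul_one_div_cancel hq0.ne', Real.rpow_one]

/-- **Riesz representation** of the dual of `Lᵖ`, `1 < p < ∞`, of a finite measure. -/
theorem exists_dual_Lp_eq_integral {p q : ℝ} (hpq : p.HolderConjugate q)
    [Fact (1 ≤ ENNReal.ofReal p)] (ℓ : StrongDual ℝ (Lp ℝ (ENNReal.ofReal p) μ)) :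
    ∃ g : α → ℝ, Measurable g ∧ Integrable (fun x => |g x| ^ q) μ ∧
      (∫ x, |g x| ^ q ∂μ) ^ (1 / q) ≤ ‖ℓ‖ ∧
      ∀ f : Lp ℝ (ENNReal.ofReal p) μ, ℓ f = ∫ x, g x * f x ∂μ := by
  obtain ⟨g, hgm, hgi, hg⟩ := exists_integrable_dual_indicatorConstLp ENNReal.ofReal_ne_top ℓ
  obtain ⟨hgInt, hle⟩ := integrable_rpow_of_abs_integral_mul_le hpq hgm (norm_nonneg ℓ)
    fun φ hφ ⟨C, hC⟩ => abs_integral_mul_le_of_dual hpq.lt ℓ hgi hg hφ hC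
  refine ⟨g, hgm, hgInt, hle, ?_⟩
  have hq0 := hpq.symm.pos
  have hgq : MemLp g (ENNReal.ofReal q) μ := by
    rw [← integrable_norm_rpow_iff hgm.aestronglyMeasurable (by simpa using hq0) (by simp),
      ENNReal.toReal_ofReal hq0.le]
    exact hgInt
  have : Fact (1 ≤ ENNReal.ofReal q) :=
    ⟨by simpa using ENNReal.ofReal_le_ofReal hpq.symm.lt.le⟩
  have : (ENNReal.ofReal q).HolderConjugate (ENNReal.ofReal p) := hpq.symm.ennrealOfReal
  let T := (ContinuousLinearMap.mul ℝ ℝ).lpPairing μ (ENNReal.ofReal q) (ENNReal.ofReal p)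
    (hgq.toLp g)
  have hT : ∀ f, T f = ∫ x, g x * f x ∂μ := by
    intro f
    rw [ContinuousLinearMap.lpPairing_eq_integral]
    refine integral_congr_ae ?_
    filter_upwards [hgq.coeFn_toLp] with x hx
    simp [hx]
  intro f
  rw [← hT f]
  refine Lp.induction ENNReal.ofReal_ne_top (fun f => ℓ f = T f) (fun c s hs hμs => ?_)
    (fun f₁ f₂ _ _ _ h₁ h₂ => by rw [map_add, map_add, h₁, h₂])
    (isClosed_eq ℓ.continuous T.continuous) f
  have : (Lp.simpleFunc.indicatorConst (ENNReal.ofReal p) hs hμs.ne c :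
      Lp ℝ (ENNReal.ofReal p) μ) = c • indicatorConstLp _ hs (measure_ne_top μ s) 1 := by
    rw [Lp.simpleFunc.coe_indicatorConst, indicatorConstLp, indicatorConstLp,
      ← MemLp.toLp_const_smul]
    refine MemLp.toLp_congr _ _ (.of_forall fun x => ?_)
    by_cases hx : x ∈ s <;> simp [hx]
  rw [this, map_smul, map_smul, hg s hs, hT, ← integral_indicator hs]
  congr 1
  refine integral_congr_ae ?_
  filter_upwards [indicatorConstLp_coeFn (p := ENNReal.ofReal p) (hs := hs)
    (hμs := measure_ne_top μ s) (c := (1 : ℝ))] with x hx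
  rw [hx]
  by_cases hx : x ∈ s <;> simp [hx]

end LpDuality

section AlteredCesaro

/-- The function `x ↦ w x * ∫_c^x f`, whose `Lᵖ` norm is the seminorm of `f` in `Ch`. -/
noncomputable def weightedPrimitive (c : ℝ) (w f : ℝ → ℝ) (x : ℝ) : ℝ :=
  w x * ∫ t in Ioc c x, f t

variable {c d p : ℝ} {w f f₁ f₂ : ℝ → ℝ}

theorem measurable_setIntegral_Ioc (c : ℝ) (hf : Measurable f) :
    Measurable fun x => ∫ t in Ioc c x, f t := by
  have hs : MeasurableSet {y : ℝ × ℝ | c < y.2 ∧ y.2 ≤ y.1} :=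
    (measurableSet_lt measurable_const measurable_snd).inter
      (measurableSet_le measurable_snd measurable_fst)
  have h := ((hf.comp measurable_snd).indicator hs).stronglyMeasurable.integral_prod_right'
    (ν := volume)
  convert! h.measurable using 2 with x
  rw [← integral_indicator measurableSet_Ioc]
  rfl

theorem measurable_weightedPrimitive (hw : Measurable w) (hf : Measurable f) :
    Measurable (weightedPrimitive c w f) :=
  hw.mul (measurable_setIntegral_Ioc c hf)

theorem memCh_iff (hp : 0 < p) (hw : Measurable w) :
    memCh c d p w f ↔ Measurable f ∧ (∀ x ∈ Ioo c d, IntegrableOn f (Ioc c x)) ∧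
      MemLp (weightedPrimitive c w f) (ENNReal.ofReal p) (volume.restrict (Ioo c d)) := by
  refine and_congr_right fun hf => and_congr_right fun _ => ?_
  rw [← integrable_norm_rpow_iff (measurable_weightedPrimitive hw hf).aestronglyMeasurable
    (by simpa using hp) (by simp), ENNReal.toReal_ofReal hp.le]
  rfl

theorem weightedPrimitive_add (h₁ : ∀ x ∈ Ioo c d, IntegrableOn f₁ (Ioc c x))
    (h₂ : ∀ x ∈ Ioo c d, IntegrableOn f₂ (Ioc c x)) :
    weightedPrimitive c w (f₁ + f₂) =ᵐ[volume.restrict (Ioo c d)]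
      weightedPrimitive c w f₁ + weightedPrimitive c w f₂ := by
  filter_upwards [ae_restrict_mem measurableSet_Ioo] with x hx
  simp only [weightedPrimitive, Pi.add_apply]
  rw [integral_add (h₁ x hx) (h₂ x hx), mul_add]

theorem weightedPrimitive_smul (a : ℝ) :
    weightedPrimitive c w (a • f) = a • weightedPrimitive c w f := by
  ext x
  simp only [weightedPrimitive, Pi.smul_apply, smul_eq_mul]
  rw [integral_const_mul]
  ring

/-- The altered Cesàro space as a space of functions. -/
def chSubmodule (c d : ℝ) (hp : 0 < p) (hw : Measurable w) : Submodule ℝ (ℝ → ℝ) where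
  carrier := {f | memCh c d p w f}
  add_mem' := by
    intro f₁ f₂ h₁ h₂
    simp only [mem_ofPred_eq, memCh_iff hp hw] at *
    exact ⟨h₁.1.add h₂.1, fun x hx => (h₁.2.1 x hx).add (h₂.2.1 x hx),
      (h₁.2.2.add h₂.2.2).ae_eq (weightedPrimitive_add h₁.2.1 h₂.2.1).symm⟩
  zero_mem' := by
    rw [mem_ofPred_eq, memCh_iff hp hw]
    refine ⟨measurable_zero, fun x _ => integrableOn_zero, ?_⟩
    have : weightedPrimitive c w 0 = 0 := by
      ext x
      simp [weightedPrimitive]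
    rw [this]
    exact MemLp.zero
  smul_mem' := by
    intro a f h
    simp only [mem_ofPred_eq, memCh_iff hp hw] at *
    refine ⟨h.1.const_smul a, fun x hx => (h.2.1 x hx).smul a, ?_⟩
    rw [weightedPrimitive_smul]
    exact h.2.2.const_smul a

/-- The isometric map `f ↦ w * ∫_c^x f` from the altered Cesàro space to `Lᵖ`. -/
noncomputable def chToLp (c d : ℝ) (hp : 0 < p) (hw : Measurable w) :
    chSubmodule c d hp hw →ₗ[ℝ] Lp ℝ (ENNReal.ofReal p) (volume.restrict (Ioo c d)) where
  toFun f := ((memCh_iff hp hw).1 f.2).2.2.toLp _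
  map_add' f₁ f₂ := by
    rw [← MemLp.toLp_add]
    exact MemLp.toLp_congr _ _ (weightedPrimitive_add ((memCh_iff hp hw).1 f₁.2).2.1
      ((memCh_iff hp hw).1 f₂.2).2.1)
  map_smul' a f := by
    rw [RingHom.id_apply, ← MemLp.toLp_const_smul]
    exact MemLp.toLp_congr _ _ (.of_forall fun x => congrFun (weightedPrimitive_smul a) x)

theorem norm_chToLp (hp : 0 < p) (hw : Measurable w) (f : chSubmodule c d hp hw) :
    ‖chToLp c d hp hw f‖ = chNorm c d p w f := by
  have hm := ((memCh_iff hp hw).1 f.2).2.2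
  change ‖hm.toLp _‖ = _
  rw [Lp.norm_toLp, hm.eLpNorm_eq_integral_rpow_norm (by simpa using hp) (by simp),
    ENNReal.toReal_ofReal (Real.rpow_nonneg (integral_nonneg fun x => by positivity) _),
    ENNReal.toReal_ofReal hp.le, chNorm, one_div]
  rfl

end AlteredCesaro

/-- A linear functional on the domain of a linear map `T` which is bounded by `M * ‖T x‖` factors
through a continuous functional of norm at most `M`. -/
theorem exists_strongDual_comp_eq {V E : Type*} [AddCommGroup V] [Module ℝ V]
    [NormedAddCommGroup E] [NormedSpace ℝ E] (T : V →ₗ[ℝ] E) (L : V →ₗ[ℝ] ℝ) {M : ℝ} (hM : 0 ≤ M)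
    (h : ∀ x, |L x| ≤ M * ‖T x‖) : ∃ ℓ : StrongDual ℝ E, (∀ x, ℓ (T x) = L x) ∧ ‖ℓ‖ ≤ M := by
  obtain ⟨s, hs⟩ := T.rangeRestrict.exists_rightInverse_of_surjective T.range_rangeRestrict
  have hs' : ∀ y, T (s y) = y := fun y => congrArg Subtype.val (LinearMap.congr_fun hs y)
  obtain ⟨ℓ, hℓ, hle⟩ := exists_extension_norm_eq T.range
    ((L ∘ₗ s).mkContinuous M fun y => by simpa [hs'] using h (s y))
  refine ⟨ℓ, fun x => ?_, hle.trans_le (LinearMap.mkContinuous_norm_le _ hM _)⟩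
  have h1 := hℓ ⟨T x, x, rfl⟩
  have h2 := h (s ⟨T x, x, rfl⟩ - x)
  rw [map_sub T, hs', sub_self, norm_zero, mul_zero, map_sub] at h2
  rw [h1]
  exact sub_eq_zero.1 (abs_nonpos_iff.1 h2)

theorem stmt12 (c d p q : ℝ) (hcd : c < d) (hp : 1 < p) (hq : q = p / (p - 1))
    (w : ℝ → ℝ) (hwm : Measurable w)
    (hwpos : ∀ x ∈ Ioo c d, 0 < w x)
    (hwint : ∀ x ∈ Ioo c d, IntegrableOn (fun t => w t ^ p) (Ioo x d))
    (Λ : (ℝ → ℝ) → ℝ)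
    (hadd : ∀ f₁ f₂ : ℝ → ℝ, memCh c d p w f₁ → memCh c d p w f₂ →
      Λ (f₁ + f₂) = Λ f₁ + Λ f₂)
    (hsmul : ∀ (a : ℝ) (f : ℝ → ℝ), memCh c d p w f → Λ (a • f) = a * Λ f)
    (hae : ∀ f₁ f₂ : ℝ → ℝ, memCh c d p w f₁ → memCh c d p w f₂ →
      (∀ᵐ x ∂(volume.restrict (Ioo c d)), f₁ x = f₂ x) → Λ f₁ = Λ f₂)
    (hcont : ∃ C : ℝ, 0 ≤ C ∧ ∀ f : ℝ → ℝ, memCh c d p w f →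
      |Λ f| ≤ C * chNorm c d p w f) :
    ∃ h : ℝ → ℝ, Measurable h ∧
      IntegrableOn (fun x => |h x / w x| ^ q) (Ioo c d) ∧
      (∀ f : ℝ → ℝ, memCh c d p w f →
        IntegrableOn (fun x => h x * ∫ t in Ioc c x, f t) (Ioo c d) ∧
        Λ f = ∫ x in Ioo c d, h x * ∫ t in Ioc c x, f t) ∧
      (⨆ f : ℝ → ℝ, ⨆ _ : memCh c d p w f ∧ chNorm c d p w f ≠ 0,
          ENNReal.ofReal (|Λ f| / chNorm c d p w f))
        = ENNReal.ofReal ((∫ x in Ioo c d, |h x / w x| ^ q) ^ (1/q)) := by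
  have hpq : p.HolderConjugate q := by
    rw [hq]
    exact Real.HolderConjugate.conjExponent hp
  have hp0 := hpq.pos
  have hq0 := hpq.symm.pos
  have : Fact (1 ≤ ENNReal.ofReal p) := ⟨by simpa using ENNReal.ofReal_le_ofReal hp.le⟩
  obtain ⟨C, hC0, hC⟩ := hcont
  have hch0 : ∀ f, 0 ≤ chNorm c d p w f := fun f =>
    Real.rpow_nonneg (integral_nonneg fun x => by positivity) _
  set N := ⨆ f : ℝ → ℝ, ⨆ _ : memCh c d p w f ∧ chNorm c d p w f ≠ 0,
    ENNReal.ofReal (|Λ f| / chNorm c d p w f) with hN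
  have hNC : N ≤ ENNReal.ofReal C := iSup₂_le fun f hf =>
    ENNReal.ofReal_le_ofReal (div_le_of_le_mul₀ (hch0 f) hC0 (hC f hf.1))
  have hNtop : N ≠ ⊤ := (hNC.trans_lt ENNReal.ofReal_lt_top).ne
  have hNΛ : ∀ f, memCh c d p w f → |Λ f| ≤ N.toReal * chNorm c d p w f := by
    intro f hf
    rcases eq_or_ne (chNorm c d p w f) 0 with h0 | h0
    · simpa [h0] using hC f hf
    · rw [← div_le_iff₀ ((hch0 f).lt_of_ne' h0), ← ENNReal.ofReal_le_iff_le_toReal hNtop]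
      exact le_iSup₂_of_le f ⟨hf, h0⟩ le_rfl
  let L : chSubmodule c d hp0 hwm →ₗ[ℝ] ℝ :=
    { toFun := fun f => Λ f
      map_add' := fun f₁ f₂ => hadd f₁ f₂ f₁.2 f₂.2
      map_smul' := fun a f => hsmul a f f.2 }
  obtain ⟨ℓ, hℓ, hℓN⟩ := exists_strongDual_comp_eq (chToLp c d hp0 hwm) L
    ENNReal.toReal_nonneg fun f => by
      rw [norm_chToLp]
      exact hNΛ f f.2
  obtain ⟨g, hgm, hgi, hgℓ, hg⟩ := exists_dual_Lp_eq_integral hpq ℓ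
  have hgq : MemLp g (ENNReal.ofReal q) (volume.restrict (Ioo c d)) := by
    rw [← integrable_norm_rpow_iff hgm.aestronglyMeasurable (by simpa using hq0) (by simp),
      ENNReal.toReal_ofReal hq0.le]
    exact hgi
  have hΛg : ∀ f, memCh c d p w f →
      Λ f = ∫ x in Ioo c d, g x * weightedPrimitive c w f x := by
    intro f hf
    refine (hℓ ⟨f, hf⟩).symm.trans ((hg _).trans (integral_congr_ae ?_))
    filter_upwards [((memCh_iff hp0 hwm).1 hf).2.2.coeFn_toLp] with x hx
    exact congrArg (g x * ·) hx
  have hquot : ∀ᵐ x ∂volume.restrict (Ioo c d), |g x| ^ q = |g x * w x / w x| ^ q := by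
    filter_upwards [ae_restrict_mem measurableSet_Ioo] with x hx
    rw [mul_div_cancel_right₀ _ (hwpos x hx).ne']
  have hassoc : ∀ f : ℝ → ℝ, (fun x => g x * w x * ∫ t in Ioc c x, f t)
      = fun x => g x * weightedPrimitive c w f x := fun f => by
    ext x
    exact mul_assoc _ _ _
  refine ⟨fun x => g x * w x, hgm.mul hwm, hgi.congr hquot, fun f hf => ?_, ?_⟩
  · rw [hassoc]
    have := hpq.symm.ennrealOfReal
    exact ⟨hgq.integrable_mul ((memCh_iff hp0 hwm).1 hf).2.2, hΛg f hf⟩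
  · rw [← integral_congr_ae hquot]
    refine le_antisymm (iSup₂_le fun f hf => ENNReal.ofReal_le_ofReal ?_) ?_
    · refine div_le_of_le_mul₀ (hch0 f)
        (Real.rpow_nonneg (integral_nonneg fun x => by positivity) _) ?_
      rw [hΛg f hf.1]
      refine (abs_integral_le_integral_abs).trans ?_
      simp only [abs_mul]
      exact integral_mul_norm_le_Lp_mul_Lq hpq.symm hgq ((memCh_iff hp0 hwm).1 hf.1).2.2
    · exact ENNReal.ofReal_le_of_le_toReal (hgℓ.trans hℓN)
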